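/- arXiv:2209.04078 — 3 statements merged into one kernel-verified Lean document; each statement's English description precedes it below -/
import Mathlib

section
/- Let T > 0, ε > 0, and fix reals x_init and z. Define the vanilla learned controller u_v(t, x) = −T·x / (T·(T − t) + 1) + (T² + 1)·ε·z / (T·(T − t) + 1) and the function x_v(t) = (T·(T − t) + 1) / (T² + 1) · x_init + ε·t·z for t ∈ [0, T]. Then x_v(0) = x_init and for every t ∈ [0, T] the function x_v has derivative ẋ_v(t) = u_v(t, x_v(t)); i.e. x_v solves the initial value problem generated by u_v starting at x_init. -/
/-- The function `x_v(t) = (T(T-t)+1)/(T²+1) · x_init + ε t z` solves the initial value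
problem generated by the vanilla learned controller
`u_v(t,x) = -T x / (T(T-t)+1) + (T²+1) ε z / (T(T-t)+1)` starting at `x_init`. -/
theorem lqr_vanilla_ivp (T ε x_init z : ℝ) (hT : 0 < T) (hε : 0 < ε)
    (u_v : ℝ → ℝ → ℝ)
    (hu : ∀ t x, u_v t x = -T * x / (T * (T - t) + 1)
      + (T ^ 2 + 1) * ε * z / (T * (T - t) + 1))
    (x_v : ℝ → ℝ)
    (hx : ∀ t, x_v t = (T * (T - t) + 1) / (T ^ 2 + 1) * x_init + ε * t * z) :
    x_v 0 = x_init ∧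
    ∀ t ∈ Set.Icc (0 : ℝ) T, HasDerivAt x_v (u_v t (x_v t)) t := by
  have hT2 : T ^ 2 + 1 ≠ 0 := by positivity
  refine ⟨?_, fun t ht => ?_⟩
  · rw [hx]
    field_simp
    ring
  · have hD : T * (T - t) + 1 ≠ 0 := by
      have := mul_nonneg hT.le (sub_nonneg.mpr ht.2)
      positivity
    have h : HasDerivAt (fun t => (T * (T - t) + 1) / (T ^ 2 + 1) * x_init + ε * t * z)
        (T * (-1) / (T ^ 2 + 1) * x_init + ε * 1 * z) t :=
      ((((((hasDerivAt_id' t).const_sub T).const_mul T).add_const 1).div_const _).mul_const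
        x_init).add (((hasDerivAt_id' t).const_mul ε).mul_const z)
    rw [hu, funext hx]
    convert h using 1
    field_simp
    ring
end

section
/- Let T > 0, ε > 0, and fix reals x_init and z. With u_v(t, x) = −T·x / (T·(T − t) + 1) + (T² + 1)·ε·z / (T·(T − t) + 1) and x_v(t) = (T·(T − t) + 1) / (T² + 1) · x_init + ε·t·z, the total cost of the vanilla controller satisfies the exact identity (1/T)·∫₀^T u_v(t, x_v(t))² dt + x_v(T)² = x_init² / (T² + 1) + ε²·(T² + 1)·z²; i.e. J_v − J_o = ε²·(T² + 1)·z², where J_o = x_init² / (T² + 1) is the optimal cost. -/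
open MeasureTheory intervalIntegral

/-- The total cost of the vanilla learned controller satisfies the exact identity
`(1/T) ∫₀^T u_v(t, x_v(t))² dt + x_v(T)² = x_init²/(T²+1) + ε² (T²+1) z²`,
i.e. `J_v - J_o = ε² (T²+1) z²` with `J_o = x_init²/(T²+1)` the optimal cost. -/
theorem lqr_vanilla_cost (T ε x_init z : ℝ) (hT : 0 < T) (hε : 0 < ε)
    (u_v : ℝ → ℝ → ℝ)
    (hu : ∀ t x, u_v t x = -T * x / (T * (T - t) + 1)
      + (T ^ 2 + 1) * ε * z / (T * (T - t) + 1))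
    (x_v : ℝ → ℝ)
    (hx : ∀ t, x_v t = (T * (T - t) + 1) / (T ^ 2 + 1) * x_init + ε * t * z) :
    (1 / T) * (∫ t in (0 : ℝ)..T, (u_v t (x_v t)) ^ 2) + (x_v T) ^ 2
      = x_init ^ 2 / (T ^ 2 + 1) + ε ^ 2 * (T ^ 2 + 1) * z ^ 2 := by
  have hS : T ^ 2 + 1 ≠ 0 := by positivity
  have hconst : ∫ t in (0 : ℝ)..T, (u_v t (x_v t)) ^ 2
      = ∫ _ in (0 : ℝ)..T, (-T * x_init / (T ^ 2 + 1) + ε * z) ^ 2 := by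
    refine integral_congr fun t ht => ?_
    rw [Set.uIcc_of_le hT.le] at ht
    have hD : T * (T - t) + 1 ≠ 0 := by
      have := mul_nonneg hT.le (sub_nonneg.2 ht.2)
      positivity
    simp only [hu, hx]
    congr 1
    field_simp
    ring
  rw [hconst, intervalIntegral.integral_const, hx, smul_eq_mul]
  field_simp
  ring
end

section
/- Let T be a positive integer, ε > 0, i an integer with 0 ≤ i ≤ T − 1, and x_i, z ∈ ℝ. Define x(t) = (T·(T − t) + 1) / (T·(T − i) + 1) · x_i + (t − i)·ε·z for t ∈ [i, i + 1]. Then x(i) = x_i and for every t ∈ [i, i + 1] the function x has derivative ẋ(t) = −T·x(t) / (T·(T − t) + 1) + (T·(T − i) + 1)·ε·z / (T·(T − t) + 1); i.e. x solves on [i, i + 1] the initial value problem generated by the adaptive learned controller u_a(t, x) = −T·x / (T·(T − t) + 1) + (T·(T − i) + 1)·ε·z / (T·(T − t) + 1) with x(i) = x_i. -/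
/-- On the interval `[i, i+1]`, the function
`x(t) = (T(T-t)+1)/(T(T-i)+1) · xᵢ + (t-i) ε z` solves the initial value problem generated
by the adaptive learned controller
`u_a(t, x) = -T x / (T(T-t)+1) + (T(T-i)+1) ε z / (T(T-t)+1)` with `x(i) = xᵢ`. -/
theorem lqr_adaptive_ivp (T : ℕ) (hT : 0 < T) (ε : ℝ) (hε : 0 < ε)
    (i : ℕ) (hi : i ≤ T - 1) (x_i z : ℝ)
    (x : ℝ → ℝ)
    (hx : ∀ t, x t = ((T : ℝ) * ((T : ℝ) - t) + 1) / ((T : ℝ) * ((T : ℝ) - (i : ℝ)) + 1) * x_i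
      + (t - (i : ℝ)) * ε * z) :
    x (i : ℝ) = x_i ∧
    ∀ t ∈ Set.Icc (i : ℝ) ((i : ℝ) + 1),
      HasDerivAt x
        (-(T : ℝ) * x t / ((T : ℝ) * ((T : ℝ) - t) + 1)
          + ((T : ℝ) * ((T : ℝ) - (i : ℝ)) + 1) * ε * z / ((T : ℝ) * ((T : ℝ) - t) + 1)) t := by
  have hiT : (i : ℝ) + 1 ≤ T := by exact_mod_cast (by omega : i + 1 ≤ T)
  have ne_zero_of_le : ∀ s : ℝ, s ≤ T → (T : ℝ) * ((T : ℝ) - s) + 1 ≠ 0 := fun s hs => by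
    have := mul_nonneg (Nat.cast_nonneg (α := ℝ) T) (sub_nonneg.mpr hs)
    positivity
  have hi0 := ne_zero_of_le i (by linarith)
  refine ⟨by rw [hx, div_self hi0]; ring, fun t ht => ?_⟩
  have ht0 := ne_zero_of_le t (ht.2.trans hiT)
  have hd : HasDerivAt x
      ((T : ℝ) * (-1) / ((T : ℝ) * ((T : ℝ) - i) + 1) * x_i + 1 * ε * z) t := by
    rw [funext hx]
    exact ((((((hasDerivAt_id t).const_sub (T : ℝ)).const_mul (T : ℝ)).add_const 1).div_const
      _).mul_const x_i).add
        ((((hasDerivAt_id t).sub_const (i : ℝ)).mul_const ε).mul_const z)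
  convert hd using 1
  rw [hx]
  field_simp
  ring
end
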